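/- arXiv:1904.05481 — 2 statements merged into one kernel-verified Lean document; each statement's English description precedes it below -/
import Mathlib

section
/- Let p₁, p₂ be transition probability functions with p₂ monotone and convexity-preserving and p₂ ⪰_CX p₁, and let g₁, g₂ : S → A be bounded measurable policy functions with g₂ increasing and convex in s and g₂(s) ≥ g₁(s) for all s ∈ S. For a common initial state s(1) ∈ S, let μᵢᵗ be the state distributions induced by the kernel Pᵢ(s,·) = pᵢ(s,gᵢ(s),·). Then ∫_S g₂ dμ₂ᵗ ≥ ∫_S g₁ dμ₁ᵗ for all t ∈ ℕ. -/
set_option autoImplicit false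

open MeasureTheory

/-- State distributions induced by a Markov kernel `P` from initial state `s0`:
`iterDist P s0 0 = δ_{s0}` (period 1) and `μ^{t+1}(B) = ∫ P(s,B) μ^t(ds)`. -/
noncomputable def iterDist {α : Type*} [MeasurableSpace α]
    (P : α → Measure α) (s0 : α) : ℕ → Measure α
  | 0 => Measure.dirac s0
  | t + 1 => (iterDist P s0 t).bind P

open ProbabilityTheory

theorem exists_isMarkovKernel_eqOn {α : Type*} [MeasurableSpace α] {S : Set α}
    (hS : MeasurableSet S) {P : α → Measure α} (hP : Measurable P)
    (hprob : ∀ s ∈ S, IsProbabilityMeasure (P s)) :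
    ∃ κ : Kernel α α, IsMarkovKernel κ ∧ Set.EqOn κ P S := by
  classical
  refine ⟨⟨S.piecewise P Measure.dirac, hP.piecewise hS Measure.measurable_dirac⟩,
    ⟨fun s => ?_⟩, fun s hs => Set.piecewise_eq_of_mem S P Measure.dirac hs⟩
  change IsProbabilityMeasure (S.piecewise P Measure.dirac s)
  by_cases hs : s ∈ S
  · simpa [hs] using hprob s hs
  · simpa [hs] using Measure.dirac.isProbabilityMeasure

theorem integral_comp_measure {α β : Type*} [MeasurableSpace α] [MeasurableSpace β]
    (μ : Measure α) [SFinite μ] (κ : Kernel α β) [IsSFiniteKernel κ] {f : β → ℝ}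
    (hf : Integrable f (κ ∘ₘ μ)) : ∫ y, f y ∂(κ ∘ₘ μ) = ∫ x, ∫ y, f y ∂κ x ∂μ := by
  have h := Kernel.integral_comp (κ := Kernel.const Unit μ) (η := κ) (a := ()) (f := f)
  rw [Kernel.comp_apply, Kernel.const_apply] at h
  exact h hf

theorem integrable_of_measurable_of_bounded {α : Type*} [MeasurableSpace α] {μ : Measure α}
    [IsFiniteMeasure μ] {f : α → ℝ} (hf : Measurable f) (hbdd : ∃ C : ℝ, ∀ x, |f x| ≤ C) :
    Integrable f μ :=
  let ⟨C, hC⟩ := hbdd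
  .of_bound hf.aestronglyMeasurable C (.of_forall hC)

section StateDistributions

variable {α : Type*} [MeasurableSpace α] {S : Set α} {P : α → Measure α} {s0 : α}

theorem iterDist_isProbabilityMeasure_and_ae_mem (hS : MeasurableSet S) (hP : Measurable P)
    (hprob : ∀ s ∈ S, IsProbabilityMeasure (P s) ∧ P s S = 1) (hs0 : s0 ∈ S) (t : ℕ) :
    IsProbabilityMeasure (iterDist P s0 t) ∧ ∀ᵐ s ∂iterDist P s0 t, s ∈ S := by
  induction t with
  | zero =>
    exact ⟨Measure.dirac.isProbabilityMeasure, (ae_dirac_iff hS).2 hs0⟩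
  | succ t ih =>
    obtain ⟨_, hmem⟩ := ih
    obtain ⟨κ, _, hκ⟩ := exists_isMarkovKernel_eqOn hS hP fun s hs => (hprob s hs).1
    have hbind : iterDist P s0 (t + 1) = κ ∘ₘ iterDist P s0 t :=
      Measure.bind_congr_right (hmem.mono fun s hs => (hκ hs).symm)
    rw [hbind]
    refine ⟨inferInstance, Measure.ae_comp_of_ae_ae hS (hmem.mono fun s hs => ?_)⟩
    rw [hκ hs]
    have := (hprob s hs).1
    exact mem_ae_iff_prob_eq_one hS |>.2 (hprob s hs).2

theorem integral_iterDist_succ (hS : MeasurableSet S) (hP : Measurable P)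
    (hprob : ∀ s ∈ S, IsProbabilityMeasure (P s) ∧ P s S = 1) (hs0 : s0 ∈ S) (t : ℕ)
    {f : α → ℝ} (hf : Measurable f) (hbdd : ∃ C : ℝ, ∀ x, |f x| ≤ C) :
    ∫ x, f x ∂iterDist P s0 (t + 1) =
      ∫ s, S.indicator (fun s => ∫ x, f x ∂P s) s ∂iterDist P s0 t := by
  obtain ⟨_, hmem⟩ := iterDist_isProbabilityMeasure_and_ae_mem hS hP hprob hs0 t
  obtain ⟨κ, _, hκ⟩ := exists_isMarkovKernel_eqOn hS hP fun s hs => (hprob s hs).1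
  have hbind : iterDist P s0 (t + 1) = κ ∘ₘ iterDist P s0 t :=
    Measure.bind_congr_right (hmem.mono fun s hs => (hκ hs).symm)
  rw [hbind, integral_comp_measure _ _ (integrable_of_measurable_of_bounded hf hbdd)]
  refine integral_congr_ae (hmem.mono fun s hs => ?_)
  simp only [Set.indicator_of_mem hs, hκ hs]

theorem measurable_indicator_integral (hS : MeasurableSet S) (hP : Measurable P)
    (hprob : ∀ s ∈ S, IsProbabilityMeasure (P s)) {f : α → ℝ} (hf : Measurable f) :
    Measurable (S.indicator fun s => ∫ x, f x ∂P s) := by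
  obtain ⟨κ, _, hκ⟩ := exists_isMarkovKernel_eqOn hS hP hprob
  have h : (S.indicator fun s => ∫ x, f x ∂P s) = S.indicator fun s => ∫ x, f x ∂κ s :=
    Set.indicator_congr fun s hs => by rw [hκ hs]
  rw [h]
  exact hf.stronglyMeasurable.integral_kernel.measurable.indicator hS

theorem exists_abs_indicator_integral_le (hprob : ∀ s ∈ S, IsProbabilityMeasure (P s))
    {f : α → ℝ} (hbdd : ∃ C : ℝ, ∀ x, |f x| ≤ C) :
    ∃ C : ℝ, ∀ s, |S.indicator (fun s => ∫ x, f x ∂P s) s| ≤ C := by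
  obtain ⟨C, hC⟩ := hbdd
  refine ⟨C, fun s => ?_⟩
  by_cases hs : s ∈ S
  · have := hprob s hs
    rw [Set.indicator_of_mem hs]
    simpa using norm_integral_le_of_norm_le_const (μ := P s) (f := f) (.of_forall hC)
  · rw [Set.indicator_of_notMem hs, abs_zero]
    exact (abs_nonneg _).trans (hC s)

/-- If the one-step operators of `P₁` and `P₂` are ordered on a class `F` of bounded measurable
functions which the one-step operator of `P₂` preserves, then so are the expectations of functions
in `F` under the induced state distributions. -/
theorem integral_iterDist_le {P₁ P₂ : α → Measure α} (hS : MeasurableSet S)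
    (hP₁ : Measurable P₁) (hP₂ : Measurable P₂)
    (hprob₁ : ∀ s ∈ S, IsProbabilityMeasure (P₁ s) ∧ P₁ s S = 1)
    (hprob₂ : ∀ s ∈ S, IsProbabilityMeasure (P₂ s) ∧ P₂ s S = 1) (hs0 : s0 ∈ S)
    {F : Set (α → ℝ)}
    (hstable : ∀ f ∈ F, Measurable f → (∃ C : ℝ, ∀ x, |f x| ≤ C) →
      S.indicator (fun s => ∫ x, f x ∂P₂ s) ∈ F)
    (hle : ∀ f ∈ F, Measurable f → (∃ C : ℝ, ∀ x, |f x| ≤ C) →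
      ∀ s ∈ S, ∫ x, f x ∂P₁ s ≤ ∫ x, f x ∂P₂ s) (t : ℕ)
    {f : α → ℝ} (hfF : f ∈ F) (hf : Measurable f) (hbdd : ∃ C : ℝ, ∀ x, |f x| ≤ C) :
    ∫ x, f x ∂iterDist P₁ s0 t ≤ ∫ x, f x ∂iterDist P₂ s0 t := by
  have hprob₁' := fun s hs => (hprob₁ s hs).1
  have hprob₂' := fun s hs => (hprob₂ s hs).1
  induction t generalizing f with
  | zero => exact le_rfl
  | succ t ih =>
    have := (iterDist_isProbabilityMeasure_and_ae_mem hS hP₁ hprob₁ hs0 t).1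
    rw [integral_iterDist_succ hS hP₁ hprob₁ hs0 t hf hbdd,
      integral_iterDist_succ hS hP₂ hprob₂ hs0 t hf hbdd]
    have hm₂ := measurable_indicator_integral hS hP₂ hprob₂' hf
    have hb₂ := exists_abs_indicator_integral_le hprob₂' hbdd
    refine (integral_mono ?_ ?_ ?_).trans (ih (hstable f hfF hf hbdd) hm₂ hb₂)
    · exact integrable_of_measurable_of_bounded
        (measurable_indicator_integral hS hP₁ hprob₁' hf)
        (exists_abs_indicator_integral_le hprob₁' hbdd)
    · exact integrable_of_measurable_of_bounded hm₂ hb₂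
    · exact fun s => Set.indicator_rel_indicator le_rfl fun hs => hle f hfF hf hbdd s hs

end StateDistributions

/-- Theorem 2(ii): if `p₂` is monotone and convexity-preserving, `g₂` is increasing
and convex in `s`, and `g₂ ≥ g₁`, then `p₂ ⪰_CX p₁` implies
`𝔼₂ᵗ(g₂) ≥ 𝔼₁ᵗ(g₁)` for all `t`. -/
theorem scs_in_transition_cx
    {n : ℕ} (S : Set (Fin n → ℝ)) (hSmeas : MeasurableSet S) (hSconv : Convex ℝ S)
    (A : Set ℝ) (hAconv : Convex ℝ A)
    (p₁ p₂ : (Fin n → ℝ) → ℝ → Measure (Fin n → ℝ))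
    (hp₁meas : Measurable fun sa : (Fin n → ℝ) × ℝ => p₁ sa.1 sa.2)
    (hp₂meas : Measurable fun sa : (Fin n → ℝ) × ℝ => p₂ sa.1 sa.2)
    (hp₁prob : ∀ s ∈ S, ∀ a ∈ A, IsProbabilityMeasure (p₁ s a) ∧ p₁ s a S = 1)
    (hp₂prob : ∀ s ∈ S, ∀ a ∈ A, IsProbabilityMeasure (p₂ s a) ∧ p₂ s a S = 1)
    -- `p₂` is monotone
    (hp₂mono : ∀ f : (Fin n → ℝ) → ℝ, Measurable f → MonotoneOn f S →
      (∃ C : ℝ, ∀ x, |f x| ≤ C) →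
      MonotoneOn (fun sa : (Fin n → ℝ) × ℝ => ∫ x, f x ∂(p₂ sa.1 sa.2)) (S ×ˢ A))
    -- `p₂` is convexity-preserving
    (hp₂cx : ∀ f : (Fin n → ℝ) → ℝ, Measurable f → ConvexOn ℝ S f →
      (∃ C : ℝ, ∀ x, |f x| ≤ C) →
      ConvexOn ℝ (S ×ˢ A) (fun sa : (Fin n → ℝ) × ℝ => ∫ x, f x ∂(p₂ sa.1 sa.2)))
    -- `p₂ ⪰_CX p₁`
    (hcx : ∀ f : (Fin n → ℝ) → ℝ, Measurable f → ConvexOn ℝ S f →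
      (∃ C : ℝ, ∀ x, |f x| ≤ C) →
      ∀ s ∈ S, ∀ a ∈ A, ∫ x, f x ∂(p₂ s a) ≥ ∫ x, f x ∂(p₁ s a))
    (g₁ g₂ : (Fin n → ℝ) → ℝ)
    -- bounded measurable policy functions with values in `A`
    (hg₁meas : Measurable g₁) (hg₂meas : Measurable g₂)
    (hg₁bdd : ∃ C : ℝ, ∀ s, |g₁ s| ≤ C) (hg₂bdd : ∃ C : ℝ, ∀ s, |g₂ s| ≤ C)
    (hg₁A : ∀ s ∈ S, g₁ s ∈ A) (hg₂A : ∀ s ∈ S, g₂ s ∈ A)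
    -- `g₂` is increasing and convex in `s`, and `g₂ ≥ g₁`
    (hg₂mono : MonotoneOn g₂ S) (hg₂conv : ConvexOn ℝ S g₂)
    (hge : ∀ s ∈ S, g₂ s ≥ g₁ s)
    (s1 : Fin n → ℝ) (hs1 : s1 ∈ S) :
    ∀ t : ℕ,
      ∫ s in S, g₂ s ∂(iterDist (fun s => p₂ s (g₂ s)) s1 t) ≥
        ∫ s in S, g₁ s ∂(iterDist (fun s => p₁ s (g₁ s)) s1 t) := by
  have hP₁ : Measurable fun s => p₁ s (g₁ s) := hp₁meas.comp (measurable_id.prodMk hg₁meas)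
  have hP₂ : Measurable fun s => p₂ s (g₂ s) := hp₂meas.comp (measurable_id.prodMk hg₂meas)
  have hprob₁ := fun s hs => hp₁prob s hs (g₁ s) (hg₁A s hs)
  have hprob₂ := fun s hs => hp₂prob s hs (g₂ s) (hg₂A s hs)
  intro t
  obtain ⟨_, hmem₁⟩ := iterDist_isProbabilityMeasure_and_ae_mem hSmeas hP₁ hprob₁ hs1 t
  obtain ⟨_, hmem₂⟩ := iterDist_isProbabilityMeasure_and_ae_mem hSmeas hP₂ hprob₂ hs1 t
  rw [Measure.restrict_eq_self_of_ae_mem hmem₁, Measure.restrict_eq_self_of_ae_mem hmem₂]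
  refine (integral_mono_ae (integrable_of_measurable_of_bounded hg₁meas hg₁bdd)
    (integrable_of_measurable_of_bounded hg₂meas hg₂bdd) (hmem₁.mono hge)).trans ?_
  refine integral_iterDist_le (F := {f | MonotoneOn f S ∧ ConvexOn ℝ S f}) hSmeas hP₁ hP₂ hprob₁
    hprob₂ hs1 ?_ ?_ t ⟨hg₂mono, hg₂conv⟩ hg₂meas hg₂bdd
  · rintro f ⟨hfmono, hfconv⟩ hf hbdd
    have hmono := hp₂mono f hf hfmono hbdd
    have hconv := hp₂cx f hf hfconv hbdd
    constructor
    · intro x hx y hy hxy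
      rw [Set.indicator_of_mem hx, Set.indicator_of_mem hy]
      exact hmono (Set.mk_mem_prod hx (hg₂A x hx)) (Set.mk_mem_prod hy (hg₂A y hy))
        (Prod.mk_le_mk.2 ⟨hxy, hg₂mono hx hy hxy⟩)
    · refine ⟨hSconv, fun x hx y hy a b ha hb hab => ?_⟩
      have hz := hSconv hx hy ha hb hab
      rw [Set.indicator_of_mem hx, Set.indicator_of_mem hy, Set.indicator_of_mem hz]
      have hmix := hAconv (hg₂A x hx) (hg₂A y hy) ha hb hab
      exact (hmono (Set.mk_mem_prod hz (hg₂A _ hz)) (Set.mk_mem_prod hz hmix)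
        (Prod.mk_le_mk.2 ⟨le_rfl, hg₂conv.2 hx hy ha hb hab⟩)).trans
        (hconv.2 (Set.mk_mem_prod hx (hg₂A x hx)) (Set.mk_mem_prod hy (hg₂A y hy)) ha hb hab)
  · rintro f ⟨hfmono, hfconv⟩ hf hbdd s hs
    exact (hcx f hf hfconv hbdd s hs _ (hg₁A s hs)).trans
      (hp₂mono f hf hfmono hbdd (Set.mk_mem_prod hs (hg₁A s hs)) (Set.mk_mem_prod hs (hg₂A s hs))
        (Prod.mk_le_mk.2 ⟨le_rfl, hge s hs⟩))
end

section
/- In the dynamic pricing model with a reference effect and an uncertain memory factor, for discount factors 0 < β₁ ≤ β₂ < 1 and policy functions g(·,βᵢ) of the corresponding problems: g(s,β₂) ≥ g(s,β₁) for all s ∈ S, and for any common initial reference price s(1), ∫_S g(s,β₂) μ₂ᵗ(ds) ≥ ∫_S g(s,β₁) μ₁ᵗ(ds) for all t ∈ ℕ, where μᵢᵗ are the state distributions induced by Pᵢ(s,·) = p(s,g(s,βᵢ),·) from s(1). -/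
set_option autoImplicit false

open MeasureTheory

/-- A solution of the discounted dynamic program on the state set `S` with
feasible-action correspondence `Γ` and Bellman functional `H` (`H f s a = h(s,a,f)`):
`V` is the value function, a fixed point of the Bellman operator `T` with the
maximum attained; `W t = Tᵗ0` are the Bellman iterates of the zero function and
converge pointwise to `V`; `g(s) = max{a ∈ Γ(s) : h(s,a,V) = V(s)}` is the policy
function. -/
structure DPSolution {σ : Type*} (S : Set σ) (Γ : σ → Set ℝ)
    (H : (σ → ℝ) → σ → ℝ → ℝ) where
  V : σ → ℝ
  g : σ → ℝ
  W : ℕ → σ → ℝ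
  W_zero : W 0 = fun _ => 0
  bellman : ∀ s ∈ S, IsGreatest ((fun a => H V s a) '' Γ s) (V s)
  iterate : ∀ t, ∀ s ∈ S, IsGreatest ((fun a => H (W t) s a) '' Γ s) (W (t + 1) s)
  tendstoV : ∀ s ∈ S, Filter.Tendsto (fun t => W t s) Filter.atTop (nhds (V s))
  gmax : ∀ s ∈ S, IsGreatest {a ∈ Γ s | H V s a = V s} (g s)

/-- A convex function gains from spreading two points with a fixed sum. -/
lemma ConvexOn.map_add_map_le_of_add_eq {I : Set ℝ} {f : ℝ → ℝ} (hf : ConvexOn ℝ I f)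
    {x y z w : ℝ} (hx : x ∈ I) (hw : w ∈ I) (hxy : x ≤ y) (hyw : y ≤ w)
    (hsum : y + z = x + w) : f y + f z ≤ f x + f w := by
  rcases eq_or_lt_of_le (hxy.trans hyw) with h | h
  · obtain rfl : y = x := by linarith
    obtain rfl : z = w := by linarith
    exact le_rfl
  · have hd : 0 < w - x := sub_pos.2 h
    have h1 : 0 ≤ (w - y) / (w - x) := div_nonneg (by linarith) hd.le
    have h2 : 0 ≤ (y - x) / (w - x) := div_nonneg (by linarith) hd.le
    have h12 : (w - y) / (w - x) + (y - x) / (w - x) = 1 := by field_simp; ring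
    have hy := hf.2 hx hw h1 h2 h12
    have hz := hf.2 hx hw h2 h1 (by linarith)
    have ey : (w - y) / (w - x) * x + (y - x) / (w - x) * w = y := by field_simp; ring
    have ez : (y - x) / (w - x) * x + (w - y) / (w - x) * w = z := by
      obtain rfl : z = x + w - y := by linarith
      field_simp; ring
    simp only [smul_eq_mul] at hy hz
    rw [ey] at hy
    rw [ez] at hz
    have : (w - y) / (w - x) * f x + (y - x) / (w - x) * f x = f x := by
      rw [← add_mul, h12, one_mul]
    have : (w - y) / (w - x) * f w + (y - x) / (w - x) * f w = f w := by
      rw [← add_mul, h12, one_mul]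
    linarith

lemma mix_mem_Icc {lo hi γ s a : ℝ} (hγ : γ ∈ Set.Icc (0 : ℝ) 1) (hs : s ∈ Set.Icc lo hi)
    (ha : a ∈ Set.Icc lo hi) : γ * s + (1 - γ) * a ∈ Set.Icc lo hi :=
  convex_Icc lo hi hs ha hγ.1 (sub_nonneg.2 hγ.2) (by ring)

/-- The expectation of `f` at the next reference price, from reference price `s` and price `a`. -/
noncomputable def expectedNext (v : Measure ℝ) (f : ℝ → ℝ) (s a : ℝ) : ℝ :=
  ∫ γ, f (γ * s + (1 - γ) * a) ∂v

section ExpectedNext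

variable {lo hi : ℝ} {v : Measure ℝ}

lemma integrable_mix [IsFiniteMeasure v] (hv : ∀ᵐ γ ∂v, γ ∈ Set.Icc (0 : ℝ) 1) {f : ℝ → ℝ}
    (hf : MonotoneOn f (Set.Icc lo hi)) {s a : ℝ} (hs : s ∈ Set.Icc lo hi)
    (ha : a ∈ Set.Icc lo hi) : Integrable (fun γ => f (γ * s + (1 - γ) * a)) v := by
  have hlh : lo ≤ hi := hs.1.trans hs.2
  have hmono : Monotone (Set.IccExtend hlh (Set.domRestrict (Set.Icc lo hi) f)) :=
    Monotone.IccExtend hlh fun x y hxy => hf x.2 y.2 hxy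
  have hmeas : Measurable fun γ : ℝ => γ * s + (1 - γ) * a := by fun_prop
  have heq : (fun γ => Set.IccExtend hlh (Set.domRestrict (Set.Icc lo hi) f)
      (γ * s + (1 - γ) * a)) =ᵐ[v] fun γ => f (γ * s + (1 - γ) * a) := by
    filter_upwards [hv] with γ hγ
    rw [Set.IccExtend_of_mem _ _ (mix_mem_Icc hγ hs ha)]
    rfl
  refine Integrable.of_bound ((hmono.measurable.comp hmeas).aestronglyMeasurable.congr heq)
    (max |f lo| |f hi|) ?_
  filter_upwards [hv] with γ hγ
  have hm := mix_mem_Icc hγ hs ha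
  exact abs_le_max_abs_abs (hf (Set.left_mem_Icc.2 hlh) hm hm.1)
    (hf hm (Set.right_mem_Icc.2 hlh) hm.2)

variable [IsFiniteMeasure v] (hv : ∀ᵐ γ ∂v, γ ∈ Set.Icc (0 : ℝ) 1) {f : ℝ → ℝ}
  (hf : MonotoneOn f (Set.Icc lo hi))

include hv hf

lemma expectedNext_mono {s₁ s₂ a₁ a₂ : ℝ} (hs₁ : s₁ ∈ Set.Icc lo hi) (hs₂ : s₂ ∈ Set.Icc lo hi)
    (ha₁ : a₁ ∈ Set.Icc lo hi) (ha₂ : a₂ ∈ Set.Icc lo hi) (hs : s₁ ≤ s₂) (ha : a₁ ≤ a₂) :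
    expectedNext v f s₁ a₁ ≤ expectedNext v f s₂ a₂ := by
  refine integral_mono_ae (integrable_mix hv hf hs₁ ha₁) (integrable_mix hv hf hs₂ ha₂) ?_
  filter_upwards [hv] with γ hγ
  exact hf (mix_mem_Icc hγ hs₁ ha₁) (mix_mem_Icc hγ hs₂ ha₂)
    (add_le_add (mul_le_mul_of_nonneg_left hs hγ.1)
      (mul_le_mul_of_nonneg_left ha (sub_nonneg.2 hγ.2)))

lemma expectedNext_supermodular (hc : ConvexOn ℝ (Set.Icc lo hi) f) {s₁ s₂ a₁ a₂ : ℝ}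
    (hs₁ : s₁ ∈ Set.Icc lo hi) (hs₂ : s₂ ∈ Set.Icc lo hi)
    (ha₁ : a₁ ∈ Set.Icc lo hi) (ha₂ : a₂ ∈ Set.Icc lo hi) (hs : s₁ ≤ s₂) (ha : a₁ ≤ a₂) :
    expectedNext v f s₁ a₂ + expectedNext v f s₂ a₁ ≤
      expectedNext v f s₁ a₁ + expectedNext v f s₂ a₂ := by
  unfold expectedNext
  have i11 := integrable_mix hv hf hs₁ ha₁
  have i12 := integrable_mix hv hf hs₁ ha₂
  have i21 := integrable_mix hv hf hs₂ ha₁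
  have i22 := integrable_mix hv hf hs₂ ha₂
  rw [← integral_add i12 i21, ← integral_add i11 i22]
  refine integral_mono_ae (i12.add i21) (i11.add i22) ?_
  filter_upwards [hv] with γ hγ
  have h1 : γ * s₁ ≤ γ * s₂ := mul_le_mul_of_nonneg_left hs hγ.1
  have h2 : (1 - γ) * a₁ ≤ (1 - γ) * a₂ := mul_le_mul_of_nonneg_left ha (sub_nonneg.2 hγ.2)
  exact hc.map_add_map_le_of_add_eq (mix_mem_Icc hγ hs₁ ha₁) (mix_mem_Icc hγ hs₂ ha₂)
    (by linarith) (by linarith) (by ring)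

lemma expectedNext_convexOn (hc : ConvexOn ℝ (Set.Icc lo hi) f) {a : ℝ}
    (ha : a ∈ Set.Icc lo hi) : ConvexOn ℝ (Set.Icc lo hi) fun s => expectedNext v f s a := by
  refine ⟨convex_Icc lo hi, fun x hx y hy p q hp hq hpq => ?_⟩
  have ix := integrable_mix hv hf hx ha
  have iy := integrable_mix hv hf hy ha
  have iz := integrable_mix hv hf (convex_Icc lo hi hx hy hp hq hpq) ha
  simp only [smul_eq_mul, expectedNext] at iz ⊢
  rw [← integral_const_mul, ← integral_const_mul,
    ← integral_add (ix.const_mul p) (iy.const_mul q)]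
  refine integral_mono_ae iz ((ix.const_mul p).add (iy.const_mul q)) ?_
  filter_upwards [hv] with γ hγ
  have h := hc.2 (mix_mem_Icc hγ hx ha) (mix_mem_Icc hγ hy ha) hp hq hpq
  simp only [smul_eq_mul] at h
  have e : γ * (p * x + q * y) + (1 - γ) * a =
      p * (γ * x + (1 - γ) * a) + q * (γ * y + (1 - γ) * a) := by
    linear_combination (-(1 - γ) * a) * hpq
  simpa only [e, Pi.add_apply] using h

lemma expectedNext_sub {f' : ℝ → ℝ} (hf' : MonotoneOn f' (Set.Icc lo hi)) {s a : ℝ}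
    (hs : s ∈ Set.Icc lo hi) (ha : a ∈ Set.Icc lo hi) :
    expectedNext v (fun x => f' x - f x) s a = expectedNext v f' s a - expectedNext v f s a :=
  integral_sub (integrable_mix hv hf' hs ha) (integrable_mix hv hf hs ha)

/-- Discounted continuation values have increasing differences in the state-action pair and the
discount factor, when the value functions do. -/
lemma discounted_sub_mono {f' : ℝ → ℝ} (hf' : MonotoneOn f' (Set.Icc lo hi))
    (hd : MonotoneOn (fun x => f' x - f x) (Set.Icc lo hi)) {β β' : ℝ} (hβ' : 0 ≤ β')
    (hβ : β ≤ β') {s₁ s₂ a₁ a₂ : ℝ}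
    (hs₁ : s₁ ∈ Set.Icc lo hi) (hs₂ : s₂ ∈ Set.Icc lo hi)
    (ha₁ : a₁ ∈ Set.Icc lo hi) (ha₂ : a₂ ∈ Set.Icc lo hi) (hs : s₁ ≤ s₂) (ha : a₁ ≤ a₂) :
    β' * expectedNext v f' s₁ a₁ - β * expectedNext v f s₁ a₁ ≤
      β' * expectedNext v f' s₂ a₂ - β * expectedNext v f s₂ a₂ := by
  have h1 := expectedNext_mono hv hd hs₁ hs₂ ha₁ ha₂ hs ha
  rw [expectedNext_sub hv hf hf' hs₁ ha₁, expectedNext_sub hv hf hf' hs₂ ha₂] at h1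
  have h2 := expectedNext_mono hv hf hs₁ hs₂ ha₁ ha₂ hs ha
  have h3 := mul_le_mul_of_nonneg_left h1 hβ'
  have h4 := mul_le_mul_of_nonneg_left h2 (sub_nonneg.2 hβ)
  linarith

end ExpectedNext

section Maximization

variable {S A : Set ℝ}

lemma monotoneOn_of_isGreatest {h : ℝ → ℝ → ℝ} {w : ℝ → ℝ}
    (hw : ∀ s ∈ S, IsGreatest ((fun a => h s a) '' A) (w s))
    (hh : ∀ a ∈ A, MonotoneOn (fun s => h s a) S) : MonotoneOn w S := by
  intro x hx y hy hxy
  obtain ⟨a, ha, e⟩ := (hw x hx).1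
  rw [← e]
  exact (hh a ha hx hy hxy).trans ((hw y hy).2 ⟨a, ha, rfl⟩)

lemma convexOn_of_isGreatest (hS : Convex ℝ S) {h : ℝ → ℝ → ℝ} {w : ℝ → ℝ}
    (hw : ∀ s ∈ S, IsGreatest ((fun a => h s a) '' A) (w s))
    (hh : ∀ a ∈ A, ConvexOn ℝ S fun s => h s a) : ConvexOn ℝ S w := by
  refine ⟨hS, fun x hx y hy p q hp hq hpq => ?_⟩
  obtain ⟨a, ha, e⟩ := (hw _ (hS hx hy hp hq hpq)).1
  rw [← e]
  refine ((hh a ha).2 hx hy hp hq hpq).trans ?_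
  simp only [smul_eq_mul]
  exact add_le_add (mul_le_mul_of_nonneg_left ((hw x hx).2 ⟨a, ha, rfl⟩) hp)
    (mul_le_mul_of_nonneg_left ((hw y hy).2 ⟨a, ha, rfl⟩) hq)

/-- Maximization over a chain of actions preserves increasing differences in the state and a
binary parameter. -/
lemma sub_monotoneOn_of_isGreatest {h h' : ℝ → ℝ → ℝ} {w w' : ℝ → ℝ}
    (hw : ∀ s ∈ S, IsGreatest ((fun a => h s a) '' A) (w s))
    (hw' : ∀ s ∈ S, IsGreatest ((fun a => h' s a) '' A) (w' s))
    (hsa : ∀ s₁ ∈ S, ∀ s₂ ∈ S, ∀ a₁ ∈ A, ∀ a₂ ∈ A, s₁ ≤ s₂ → a₁ ≤ a₂ →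
      h s₁ a₂ + h s₂ a₁ ≤ h s₁ a₁ + h s₂ a₂)
    (hd : ∀ s₁ ∈ S, ∀ s₂ ∈ S, ∀ a₁ ∈ A, ∀ a₂ ∈ A, s₁ ≤ s₂ → a₁ ≤ a₂ →
      h' s₁ a₁ - h s₁ a₁ ≤ h' s₂ a₂ - h s₂ a₂) :
    MonotoneOn (fun s => w' s - w s) S := by
  intro x hx y hy hxy
  obtain ⟨a, ha, ea⟩ := (hw' x hx).1
  obtain ⟨b, hb, eb⟩ := (hw y hy).1
  simp only at ea eb ⊢
  rcases le_total b a with hba | hab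
  · have h1 := (hw x hx).2 ⟨b, hb, rfl⟩
    have h2 := (hw' y hy).2 ⟨a, ha, rfl⟩
    simp only at h1 h2
    linarith [hsa x hx y hy b hb a ha hxy hba, hd x hx y hy a ha a ha hxy le_rfl]
  · have h1 := (hw x hx).2 ⟨a, ha, rfl⟩
    have h2 := (hw' y hy).2 ⟨b, hb, rfl⟩
    simp only at h1 h2
    linarith [hd x hx y hy a ha b hb hxy hab]

/-- The greatest maximizer grows when the objective's increments do. -/
lemma greatest_maximizer_le {h h' : ℝ → ℝ} {m m' x x' : ℝ}
    (hm : IsGreatest (h '' A) m) (hm' : IsGreatest (h' '' A) m')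
    (hx : IsGreatest {a ∈ A | h a = m} x) (hx' : IsGreatest {a ∈ A | h' a = m'} x')
    (hd : ∀ a₁ ∈ A, ∀ a₂ ∈ A, a₁ ≤ a₂ → h a₂ - h a₁ ≤ h' a₂ - h' a₁) : x ≤ x' := by
  rcases le_total x x' with hle | hle
  · exact hle
  · have h1 := hd x' hx'.1.1 x hx.1.1 hle
    have h2 := hm.2 ⟨x', hx'.1.1, rfl⟩
    have h3 := hm'.2 ⟨x, hx.1.1, rfl⟩
    exact hx'.2 ⟨hx.1.1, le_antisymm h3 (by linarith [hx.1.2, hx'.1.2])⟩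

end Maximization

lemma monotoneOn_of_tendsto {S : Set ℝ} {W : ℕ → ℝ → ℝ} {V : ℝ → ℝ}
    (hW : ∀ t, MonotoneOn (W t) S)
    (hV : ∀ s ∈ S, Filter.Tendsto (fun t => W t s) Filter.atTop (nhds (V s))) :
    MonotoneOn V S := fun x hx y hy hxy =>
  le_of_tendsto_of_tendsto' (hV x hx) (hV y hy) fun t => hW t hx hy hxy

lemma convexOn_of_tendsto {S : Set ℝ} {W : ℕ → ℝ → ℝ} {V : ℝ → ℝ}
    (hW : ∀ t, ConvexOn ℝ S (W t))
    (hV : ∀ s ∈ S, Filter.Tendsto (fun t => W t s) Filter.atTop (nhds (V s))) :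
    ConvexOn ℝ S V := by
  refine ⟨(hW 0).1, fun x hx y hy p q hp hq hpq => ?_⟩
  exact le_of_tendsto_of_tendsto' (hV _ ((hW 0).1 hx hy hp hq hpq))
    (((hV x hx).const_smul p).add ((hV y hy).const_smul q))
    fun t => (hW t).2 hx hy hp hq hpq

section Distributions

variable {lo hi : ℝ} {v : Measure ℝ} {g : ℝ → ℝ}

/-- The transition kernel of the reference price under the pricing policy `g`. -/
noncomputable def policyKernel (v : Measure ℝ) (g : ℝ → ℝ) (s : ℝ) : Measure ℝ :=
  v.map fun γ => γ * s + (1 - γ) * g s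

lemma lintegral_policyKernel {f : ℝ → ENNReal} (hf : Measurable f) (s : ℝ) :
    ∫⁻ x, f x ∂policyKernel v g s = ∫⁻ γ, f (γ * s + (1 - γ) * g s) ∂v :=
  lintegral_map hf (by fun_prop)

variable [IsProbabilityMeasure v]

lemma measurable_policyKernel (hg : Measurable g) : Measurable (policyKernel v g) := by
  refine Measure.measurable_of_measurable_coe _ fun B hB => ?_
  have hF : Measurable fun q : ℝ × ℝ => q.2 * q.1 + (1 - q.2) * g q.1 := by fun_prop
  have heq : (fun s => policyKernel v g s B) = fun s =>
      v (Prod.mk s ⁻¹' ((fun q : ℝ × ℝ => q.2 * q.1 + (1 - q.2) * g q.1) ⁻¹' B)) := by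
    funext s
    rw [policyKernel, Measure.map_apply (by fun_prop) hB]
    rfl
  rw [heq]
  exact measurable_measure_prodMk_left (hF hB)

lemma measurable_lintegral_mix (hg : Measurable g) {f : ℝ → ENNReal} (hf : Measurable f) :
    Measurable fun s => ∫⁻ γ, f (γ * s + (1 - γ) * g s) ∂v := by
  refine Measurable.lintegral_prod_right' (f := fun q : ℝ × ℝ => f (q.2 * q.1 + (1 - q.2) * g q.1))
    (hf.comp ?_)
  fun_prop

lemma lintegral_iterDist_succ (hg : Measurable g) {f : ℝ → ENNReal} (hf : Measurable f)
    (s₀ : ℝ) (t : ℕ) :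
    ∫⁻ x, f x ∂iterDist (policyKernel v g) s₀ (t + 1) =
      ∫⁻ s, ∫⁻ γ, f (γ * s + (1 - γ) * g s) ∂v ∂iterDist (policyKernel v g) s₀ t := by
  rw [iterDist, Measure.lintegral_bind (measurable_policyKernel hg).aemeasurable hf.aemeasurable]
  simp only [lintegral_policyKernel hf]

lemma isProbabilityMeasure_iterDist (hg : Measurable g) (s₀ : ℝ) (t : ℕ) :
    IsProbabilityMeasure (iterDist (policyKernel v g) s₀ t) := by
  induction t with
  | zero => exact Measure.dirac.isProbabilityMeasure
  | succ t ih =>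
    refine ⟨?_⟩
    have := lintegral_iterDist_succ (v := v) hg (f := fun _ => 1) measurable_const s₀ t
    simpa using this

lemma ae_mem_iterDist (hv : ∀ᵐ γ ∂v, γ ∈ Set.Icc (0 : ℝ) 1) (hg : Measurable g)
    (hgS : ∀ s ∈ Set.Icc lo hi, g s ∈ Set.Icc lo hi) {s₀ : ℝ} (hs₀ : s₀ ∈ Set.Icc lo hi) (t : ℕ) :
    ∀ᵐ s ∂iterDist (policyKernel v g) s₀ t, s ∈ Set.Icc lo hi := by
  induction t with
  | zero => exact (ae_dirac_iff measurableSet_Icc).2 hs₀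
  | succ t ih =>
    have hm : MeasurableSet (Set.Icc lo hi)ᶜ := measurableSet_Icc.compl
    change iterDist (policyKernel v g) s₀ (t + 1) (Set.Icc lo hi)ᶜ = 0
    rw [iterDist, Measure.bind_apply hm (measurable_policyKernel hg).aemeasurable]
    refine lintegral_eq_zero_of_ae_eq_zero ?_
    filter_upwards [ih] with s hs
    rw [policyKernel, Pi.zero_apply, Measure.map_apply (by fun_prop) hm]
    have : ∀ᵐ γ ∂v, γ * s + (1 - γ) * g s ∈ Set.Icc lo hi := by
      filter_upwards [hv] with γ hγ using mix_mem_Icc hγ hs (hgS s hs)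
    exact this

/-- A pointwise larger, increasing policy induces first-order larger state distributions. -/
lemma lintegral_iterDist_mono (hv : ∀ᵐ γ ∂v, γ ∈ Set.Icc (0 : ℝ) 1) {g' : ℝ → ℝ}
    (hg : Measurable g) (hg' : Measurable g')
    (hgS : ∀ s ∈ Set.Icc lo hi, g s ∈ Set.Icc lo hi)
    (hgS' : ∀ s ∈ Set.Icc lo hi, g' s ∈ Set.Icc lo hi)
    (hmono : MonotoneOn g (Set.Icc lo hi)) (hle : ∀ s ∈ Set.Icc lo hi, g s ≤ g' s)
    {s₀ : ℝ} (hs₀ : s₀ ∈ Set.Icc lo hi) (t : ℕ) {f : ℝ → ENNReal} (hf : Measurable f)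
    (hfm : MonotoneOn f (Set.Icc lo hi)) :
    ∫⁻ x, f x ∂iterDist (policyKernel v g) s₀ t ≤
      ∫⁻ x, f x ∂iterDist (policyKernel v g') s₀ t := by
  induction t generalizing f with
  | zero => exact le_rfl
  | succ t ih =>
    rw [lintegral_iterDist_succ hg hf, lintegral_iterDist_succ hg' hf]
    refine (ih (measurable_lintegral_mix hg hf) ?_).trans (lintegral_mono_ae ?_)
    · intro x hx y hy hxy
      refine lintegral_mono_ae ?_
      filter_upwards [hv] with γ hγ
      exact hfm (mix_mem_Icc hγ hx (hgS x hx)) (mix_mem_Icc hγ hy (hgS y hy))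
        (add_le_add (mul_le_mul_of_nonneg_left hxy hγ.1)
          (mul_le_mul_of_nonneg_left (hmono hx hy hxy) (sub_nonneg.2 hγ.2)))
    · filter_upwards [ae_mem_iterDist hv hg' hgS' hs₀ t] with s hs
      refine lintegral_mono_ae ?_
      filter_upwards [hv] with γ hγ
      exact hfm (mix_mem_Icc hγ hs (hgS s hs)) (mix_mem_Icc hγ hs (hgS' s hs))
        (add_le_add le_rfl (mul_le_mul_of_nonneg_left (hle s hs) (sub_nonneg.2 hγ.2)))

/-- Expected policy values are ordered along the induced state distributions. -/
lemma setIntegral_policy_iterDist_mono (hv : ∀ᵐ γ ∂v, γ ∈ Set.Icc (0 : ℝ) 1) {g' : ℝ → ℝ}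
    (hg : Measurable g) (hg' : Measurable g')
    (hgS : ∀ s ∈ Set.Icc lo hi, g s ∈ Set.Icc lo hi)
    (hgS' : ∀ s ∈ Set.Icc lo hi, g' s ∈ Set.Icc lo hi)
    (hnonneg : ∀ s ∈ Set.Icc lo hi, 0 ≤ g s)
    (hmono : MonotoneOn g (Set.Icc lo hi)) (hle : ∀ s ∈ Set.Icc lo hi, g s ≤ g' s)
    {s₀ : ℝ} (hs₀ : s₀ ∈ Set.Icc lo hi) (t : ℕ) :
    ∫ s in Set.Icc lo hi, g s ∂iterDist (policyKernel v g) s₀ t ≤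
      ∫ s in Set.Icc lo hi, g' s ∂iterDist (policyKernel v g') s₀ t := by
  have hS := ae_mem_iterDist hv hg hgS hs₀ t
  have hS' := ae_mem_iterDist hv hg' hgS' hs₀ t
  have := isProbabilityMeasure_iterDist (v := v) hg' s₀ t
  rw [Measure.restrict_eq_self_of_ae_mem hS, Measure.restrict_eq_self_of_ae_mem hS',
    integral_eq_lintegral_of_nonneg_ae (hS.mono hnonneg) hg.aestronglyMeasurable,
    integral_eq_lintegral_of_nonneg_ae (hS'.mono fun s hs => (hnonneg s hs).trans (hle s hs))
      hg'.aestronglyMeasurable]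
  refine ENNReal.toReal_mono (ne_top_of_le_ne_top ENNReal.ofReal_ne_top
    ((lintegral_mono_ae (hS'.mono fun s hs => ENNReal.ofReal_le_ofReal (hgS' s hs).2)).trans
      (by simp : _ ≤ ENNReal.ofReal hi))) ?_
  refine (lintegral_iterDist_mono hv hg hg' hgS hgS' hmono hle hs₀ t hg.ennreal_ofReal
    fun x hx y hy hxy => ENNReal.ofReal_le_ofReal (hmono hx hy hxy)).trans (lintegral_mono_ae ?_)
  exact hS'.mono fun s hs => ENNReal.ofReal_le_ofReal (hle s hs)

end Distributions

/-- Proposition 2(iii) (dynamic pricing with a reference effect and an uncertain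
memory factor): a higher discount factor yields a pointwise higher optimal pricing
policy and higher expected prices in every period. -/
theorem optimal_prices_increasing_in_discount_factor
    (lo hi abar : ℝ) (hlo : lo ≤ 0) (habar : 0 ≤ abar) (hhi : abar ≤ hi)
    (D : ℝ → ℝ → ℝ)
    (hDcont : Continuous fun q : ℝ × ℝ => D q.1 q.2)
    (hDnonneg : ∀ s ∈ Set.Icc lo hi, ∀ a ∈ Set.Icc 0 abar, 0 ≤ D s a)
    (hDdec : ∀ s ∈ Set.Icc lo hi, AntitoneOn (fun a => D s a) (Set.Icc 0 abar))
    (hDinc : ∀ a ∈ Set.Icc 0 abar, MonotoneOn (fun s => D s a) (Set.Icc lo hi))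
    (hDconv : ∀ a ∈ Set.Icc 0 abar, ConvexOn ℝ (Set.Icc lo hi) (fun s => D s a))
    (hDid : ∀ s₁ ∈ Set.Icc lo hi, ∀ s₂ ∈ Set.Icc lo hi,
      ∀ a₁ ∈ Set.Icc 0 abar, ∀ a₂ ∈ Set.Icc 0 abar, s₁ ≤ s₂ → a₁ ≤ a₂ →
      D s₂ a₂ - D s₂ a₁ ≥ D s₁ a₂ - D s₁ a₁)
    (v : Measure ℝ) (hv : IsProbabilityMeasure v) (hvsupp : v (Set.Icc 0 1) = 1)
    -- for each discount factor `β ∈ (0,1)`, a solution of the corresponding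
    -- dynamic program
    (sol : ∀ β : Set.Ioo (0:ℝ) 1,
      DPSolution (Set.Icc lo hi) (fun _ => Set.Icc 0 abar)
        (fun f s a => a * D s a + β * ∫ γ, f (γ * s + (1 - γ) * a) ∂v))
    (hgmeas : ∀ β, Measurable (sol β).g)
    (β₁ β₂ : Set.Ioo (0:ℝ) 1) (hβ : (β₁ : ℝ) ≤ (β₂ : ℝ)) :
    -- `g(s,β₂) ≥ g(s,β₁)` for all `s ∈ S`
    (∀ s ∈ Set.Icc lo hi, (sol β₂).g s ≥ (sol β₁).g s) ∧
    -- and the expected prices in every period are higher under `β₂`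
    (∀ s1 ∈ Set.Icc lo hi, ∀ t : ℕ,
      ∫ s in Set.Icc lo hi, (sol β₂).g s
          ∂(iterDist (fun s => v.map fun γ => γ * s + (1 - γ) * (sol β₂).g s) s1 t) ≥
        ∫ s in Set.Icc lo hi, (sol β₁).g s
          ∂(iterDist (fun s => v.map fun γ => γ * s + (1 - γ) * (sol β₁).g s) s1 t)) := by
  have hv01 : ∀ᵐ γ ∂v, γ ∈ Set.Icc (0 : ℝ) 1 := (mem_ae_iff_prob_eq_one measurableSet_Icc).2 hvsupp
  have hAS : ∀ a ∈ Set.Icc 0 abar, a ∈ Set.Icc lo hi :=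
    fun a ha => ⟨hlo.trans ha.1, ha.2.trans hhi⟩
  let H (β : ℝ) (f : ℝ → ℝ) (s a : ℝ) : ℝ := a * D s a + β * expectedNext v f s a
  have hHmono : ∀ β, 0 ≤ β → ∀ f, MonotoneOn f (Set.Icc lo hi) → ∀ a ∈ Set.Icc 0 abar,
      MonotoneOn (fun s => H β f s a) (Set.Icc lo hi) := fun β hβ0 f hf a ha x hx y hy hxy =>
    add_le_add (mul_le_mul_of_nonneg_left (hDinc a ha hx hy hxy) ha.1)
      (mul_le_mul_of_nonneg_left
        (expectedNext_mono hv01 hf hx hy (hAS a ha) (hAS a ha) hxy le_rfl) hβ0)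
  have hHconv : ∀ β, 0 ≤ β → ∀ f, MonotoneOn f (Set.Icc lo hi) → ConvexOn ℝ (Set.Icc lo hi) f →
      ∀ a ∈ Set.Icc 0 abar, ConvexOn ℝ (Set.Icc lo hi) (fun s => H β f s a) :=
    fun β hβ0 f hf hc a ha => ((hDconv a ha).smul ha.1).add
      ((expectedNext_convexOn hv01 hf hc (hAS a ha)).smul hβ0)
  have hHsuper : ∀ β, 0 ≤ β → ∀ f, MonotoneOn f (Set.Icc lo hi) → ConvexOn ℝ (Set.Icc lo hi) f →
      ∀ s₁ ∈ Set.Icc lo hi, ∀ s₂ ∈ Set.Icc lo hi, ∀ a₁ ∈ Set.Icc 0 abar, ∀ a₂ ∈ Set.Icc 0 abar,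
      s₁ ≤ s₂ → a₁ ≤ a₂ → H β f s₁ a₂ + H β f s₂ a₁ ≤ H β f s₁ a₁ + H β f s₂ a₂ := by
    intro β hβ0 f hf hc s₁ hs₁ s₂ hs₂ a₁ ha₁ a₂ ha₂ hs ha
    have h1 := mul_le_mul_of_nonneg_left (expectedNext_supermodular hv01 hf hc hs₁ hs₂
      (hAS a₁ ha₁) (hAS a₂ ha₂) hs ha) hβ0
    have h2 := mul_le_mul_of_nonneg_left (hDid s₁ hs₁ s₂ hs₂ a₁ ha₁ a₂ ha₂ hs ha) ha₁.1
    have h3 := mul_le_mul_of_nonneg_right ha (sub_nonneg.2 (hDinc a₂ ha₂ hs₁ hs₂ hs))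
    simp only [H] at h3 ⊢
    linarith
  have hiter (β : Set.Ioo (0 : ℝ) 1) (t : ℕ) : MonotoneOn ((sol β).W t) (Set.Icc lo hi) ∧
      ConvexOn ℝ (Set.Icc lo hi) ((sol β).W t) := by
    induction t with
    | zero =>
      rw [(sol β).W_zero]
      exact ⟨monotoneOn_const, convexOn_const _ (convex_Icc lo hi)⟩
    | succ t ih =>
      exact ⟨monotoneOn_of_isGreatest ((sol β).iterate t) (hHmono β β.2.1.le _ ih.1),
        convexOn_of_isGreatest (convex_Icc lo hi) ((sol β).iterate t)
          (hHconv β β.2.1.le _ ih.1 ih.2)⟩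
  have hVmono (β : Set.Ioo (0 : ℝ) 1) : MonotoneOn (sol β).V (Set.Icc lo hi) :=
    monotoneOn_of_tendsto (fun t => (hiter β t).1) (sol β).tendstoV
  have hVconv (β : Set.Ioo (0 : ℝ) 1) : ConvexOn ℝ (Set.Icc lo hi) (sol β).V :=
    convexOn_of_tendsto (fun t => (hiter β t).2) (sol β).tendstoV
  have hHdiff : ∀ f f', MonotoneOn f (Set.Icc lo hi) → MonotoneOn f' (Set.Icc lo hi) →
      MonotoneOn (fun x => f' x - f x) (Set.Icc lo hi) →
      ∀ s₁ ∈ Set.Icc lo hi, ∀ s₂ ∈ Set.Icc lo hi, ∀ a₁ ∈ Set.Icc 0 abar, ∀ a₂ ∈ Set.Icc 0 abar,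
      s₁ ≤ s₂ → a₁ ≤ a₂ → H β₂ f' s₁ a₁ - H β₁ f s₁ a₁ ≤ H β₂ f' s₂ a₂ - H β₁ f s₂ a₂ := by
    intro f f' hf hf' hd s₁ hs₁ s₂ hs₂ a₁ ha₁ a₂ ha₂ hs ha
    have := discounted_sub_mono hv01 hf hf' hd β₂.2.1.le hβ hs₁ hs₂ (hAS a₁ ha₁) (hAS a₂ ha₂) hs ha
    simp only [H]
    linarith
  have hWdiff (t : ℕ) :
      MonotoneOn (fun s => (sol β₂).W t s - (sol β₁).W t s) (Set.Icc lo hi) := by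
    induction t with
    | zero =>
      rw [(sol β₁).W_zero, (sol β₂).W_zero]
      exact monotoneOn_const
    | succ t ih =>
      exact sub_monotoneOn_of_isGreatest ((sol β₁).iterate t) ((sol β₂).iterate t)
        (hHsuper β₁ β₁.2.1.le _ (hiter β₁ t).1 (hiter β₁ t).2)
        (hHdiff _ _ (hiter β₁ t).1 (hiter β₂ t).1 ih)
  have hVdiff : MonotoneOn (fun s => (sol β₂).V s - (sol β₁).V s) (Set.Icc lo hi) :=
    monotoneOn_of_tendsto hWdiff fun s hs => ((sol β₂).tendstoV s hs).sub ((sol β₁).tendstoV s hs)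
  have hle : ∀ s ∈ Set.Icc lo hi, (sol β₁).g s ≤ (sol β₂).g s := fun s hs =>
    greatest_maximizer_le ((sol β₁).bellman s hs) ((sol β₂).bellman s hs)
      ((sol β₁).gmax s hs) ((sol β₂).gmax s hs) fun a₁ ha₁ a₂ ha₂ ha => by
        have := hHdiff _ _ (hVmono β₁) (hVmono β₂) hVdiff s hs s hs a₁ ha₁ a₂ ha₂ le_rfl ha
        simp only [H, expectedNext] at this
        linarith
  have hgmono : MonotoneOn (sol β₁).g (Set.Icc lo hi) := fun x hx y hy hxy =>
    greatest_maximizer_le ((sol β₁).bellman x hx) ((sol β₁).bellman y hy)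
      ((sol β₁).gmax x hx) ((sol β₁).gmax y hy) fun a₁ ha₁ a₂ ha₂ ha => by
        have := hHsuper β₁ β₁.2.1.le _ (hVmono β₁) (hVconv β₁) x hx y hy a₁ ha₁ a₂ ha₂ hxy ha
        simp only [H, expectedNext] at this
        linarith
  have hgA (β : Set.Ioo (0 : ℝ) 1) : ∀ s ∈ Set.Icc lo hi, (sol β).g s ∈ Set.Icc 0 abar :=
    fun s hs => ((sol β).gmax s hs).1.1
  exact ⟨hle, fun s₁ hs₁ t => setIntegral_policy_iterDist_mono hv01 (hgmeas β₁) (hgmeas β₂)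
    (fun s hs => hAS _ (hgA β₁ s hs)) (fun s hs => hAS _ (hgA β₂ s hs))
    (fun s hs => (hgA β₁ s hs).1) hgmono hle hs₁ t⟩
end
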